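/- Fix a ∈ ℂ∖{0} and λ ∈ ℝ∖{0}. For all smooth functions Φ⁰ : ∂Δ → ℝ, Φ^α : ∂Δ → ℂ (1 ≤ α ≤ n−1), and Φⁿ : ∂Δ → ℝ, there exist functions h^α, h̃ⁿ, k̃_α, kₙ (1 ≤ α ≤ n−1), each continuous on Δ̄ and holomorphic on Δ, such that for all ζ ∈ ∂Δ: (i) h̃ⁿ(ζ) + conj(h̃ⁿ(ζ)) − (i·conj(a)/2)·Σ_α A_{1̄ᾱ}·conj(h^α(ζ))·ζ̄ + (i·a/2)·Σ_α conj(A_{1̄ᾱ})·h^α(ζ)·ζ + i·conj(a)·Σ_α A_{1̄ᾱ}·conj(ℐ(h^α)(ζ)) − i·a·Σ_α conj(A_{1̄ᾱ})·ℐ(h^α)(ζ) − conj(a)·h¹(ζ)·ζ̄ − a·conj(h¹(ζ))·ζ = Φ⁰(ζ); (ii) for each α: k̃_α(ζ) − i·a·conj(A_{ᾱ1̄})·conj(kₙ(ζ))·ζ + δ_α¹·conj(a)·kₙ(ζ)·ζ̄ − i·λ·Σ_β conj(A_{ᾱβ̄})·h^β(ζ)·ζ̄ + (i·a/2)·conj(A_{ᾱ1̄})·ζ·kₙ(ζ)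 + λ·(conj(h^α(ζ)) + (i/2)·Σ_β conj(A_{ᾱβ̄})·h^β(ζ))·ζ = Φ^α(ζ); (iii) ζ̄·kₙ(ζ) − ζ·conj(kₙ(ζ)) = i·Φⁿ(ζ). In other words, the linearized Riemann–Hilbert boundary problem at the disc f̂_{a,λ} is solvable for arbitrary right-hand side. -/

import Mathlib

open Complex ComplexConjugate Finset

noncomputable section

/-- `f` is continuous on the closed unit disc and holomorphic inside, and `Q` is the primitive of
`ζ ↦ ζ * f ζ` vanishing at `0`, continuous up to the boundary. -/
def IsDiscWithPrimitive (f Q : ℂ → ℂ) : Prop :=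
  (ContinuousOn f (Metric.closedBall 0 1) ∧ DifferentiableOn ℂ f (Metric.ball 0 1)) ∧
    ContinuousOn Q (Metric.closedBall 0 1) ∧ Q 0 = 0 ∧
    ∀ ζ ∈ Metric.ball (0 : ℂ) 1, HasDerivAt Q (ζ * f ζ) ζ

namespace IsDiscWithPrimitive

variable {f g Q R : ℂ → ℂ}

theorem add (hf : IsDiscWithPrimitive f Q) (hg : IsDiscWithPrimitive g R) :
    IsDiscWithPrimitive (fun ζ => f ζ + g ζ) (fun ζ => Q ζ + R ζ) := by
  obtain ⟨⟨hfc, hfd⟩, hQc, hQ0, hQ⟩ := hf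
  obtain ⟨⟨hgc, hgd⟩, hRc, hR0, hR⟩ := hg
  refine ⟨⟨hfc.add hgc, hfd.add hgd⟩, hQc.add hRc, by simp [hQ0, hR0], fun ζ hζ => ?_⟩
  rw [mul_add]
  exact (hQ ζ hζ).add (hR ζ hζ)

theorem const_mul (hf : IsDiscWithPrimitive f Q) (c : ℂ) :
    IsDiscWithPrimitive (fun ζ => c * f ζ) (fun ζ => c * Q ζ) := by
  obtain ⟨⟨hfc, hfd⟩, hQc, hQ0, hQ⟩ := hf
  refine ⟨⟨hfc.const_mul c, hfd.const_mul c⟩, hQc.const_mul c, by simp [hQ0], fun ζ hζ => ?_⟩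
  rw [mul_left_comm]
  exact (hQ ζ hζ).const_mul c

/-- A power series with absolutely summable coefficients defines a function continuous on the
closed disc, together with its weighted primitive. -/
theorem of_summable {c : ℕ → ℂ} (hc : Summable fun k => ‖c k‖) (m : ℕ → ℕ) :
    IsDiscWithPrimitive (fun ζ => ∑' k, c k * ζ ^ m k)
      (fun ζ => ∑' k, c k * (ζ ^ (m k + 2) / ((m k + 2 : ℕ) : ℂ))) := by
  have hpow : ∀ (j : ℕ) (ζ : ℂ), ζ ∈ Metric.closedBall (0 : ℂ) 1 → ‖ζ ^ j‖ ≤ 1 := by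
    intro j ζ hζ
    rw [norm_pow]
    exact pow_le_one₀ (norm_nonneg _) (by simpa using hζ)
  have hterm : ∀ (k j : ℕ) (ζ : ℂ), ζ ∈ Metric.closedBall (0 : ℂ) 1 →
      ‖c k * ζ ^ j‖ ≤ ‖c k‖ := by
    intro k j ζ hζ
    rw [norm_mul]
    exact mul_le_of_le_one_right (norm_nonneg _) (hpow j ζ hζ)
  have hprim : ∀ (k : ℕ) (ζ : ℂ), ζ ∈ Metric.closedBall (0 : ℂ) 1 →
      ‖c k * (ζ ^ (m k + 2) / ((m k + 2 : ℕ) : ℂ))‖ ≤ ‖c k‖ := by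
    intro k ζ hζ
    rw [norm_mul, norm_div, Complex.norm_natCast]
    refine mul_le_of_le_one_right (norm_nonneg _) (div_le_one_of_le₀ ?_ (by positivity))
    refine (hpow _ ζ hζ).trans ?_
    exact_mod_cast (by omega : 1 ≤ m k + 2)
  have hsub := Metric.ball_subset_closedBall (x := (0 : ℂ)) (ε := 1)
  refine ⟨⟨continuousOn_tsum (fun k => by fun_prop) hc fun k ζ hζ => hterm k _ ζ hζ,
    differentiableOn_tsum_of_summable_norm hc (fun k => by fun_prop) Metric.isOpen_ball
      fun k ζ hζ => hterm k _ ζ (hsub hζ)⟩,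
    continuousOn_tsum (fun k => by fun_prop) hc fun k ζ hζ => hprim k ζ hζ, by simp, ?_⟩
  intro ζ hζ
  have key := hasDerivAt_tsum_of_isPreconnected (𝕜 := ℂ) (y₀ := 0) (y := ζ)
    (g := fun k z => c k * (z ^ (m k + 2) / ((m k + 2 : ℕ) : ℂ)))
    (g' := fun k z => c k * z ^ (m k + 1)) hc Metric.isOpen_ball
    (convex_ball (0 : ℂ) 1).isPreconnected ?_ (fun k z hz => hterm k _ z (hsub hz))
    (by simp) (by simp) hζ
  · refine key.congr_deriv ?_
    rw [← tsum_mul_left]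
    exact tsum_congr fun k => by ring
  · intro k z _
    have hne : ((m k + 2 : ℕ) : ℂ) ≠ 0 := by exact_mod_cast (by omega : m k + 2 ≠ 0)
    refine (((hasDerivAt_pow (m k + 2) z).div_const _).const_mul (c k)).congr_deriv ?_
    rw [show m k + 2 - 1 = m k + 1 by omega]
    field_simp

end IsDiscWithPrimitive

open Real in
/-- The Fourier coefficients of a function with two continuous derivatives and matching boundary
values decay quadratically. -/
theorem norm_fourierCoeffOn_le {u u' u'' : ℝ → ℂ} (hu : ∀ t, HasDerivAt u (u' t) t)
    (hu' : ∀ t, HasDerivAt u' (u'' t) t) (hc : Continuous u'') (h0 : u 1 = u 0)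
    (h1 : u' 1 = u' 0) :
    ∃ C : ℝ, ∀ k : ℤ, k ≠ 0 →
      ‖fourierCoeffOn zero_lt_one u k‖ ≤ C * (1 / (k : ℝ) ^ 2) := by
  obtain ⟨C, hC⟩ := isCompact_Icc.exists_bound_of_continuousOn
    (s := Set.Icc (0 : ℝ) 1) hc.continuousOn
  refine ⟨C, fun k hk => ?_⟩
  have hbound : ‖fourierCoeffOn zero_lt_one u'' k‖ ≤ C := by
    rw [fourierCoeffOn_eq_integral]
    have := intervalIntegral.norm_integral_le_of_norm_le_const (a := 0) (b := 1) (C := C)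
      (f := fun x : ℝ => fourier (-k) (x : AddCircle ((1 : ℝ) - 0)) • u'' x) (fun x hx => by
        rw [Set.uIoc_of_le zero_le_one] at hx
        rw [smul_eq_mul, norm_mul, fourier_apply, Circle.norm_coe, one_mul]
        exact hC x ⟨hx.1.le, hx.2⟩)
    simpa using this
  have hcu' : Continuous u' := continuous_iff_continuousAt.2 fun t => (hu' t).continuousAt
  have e1 := fourierCoeffOn_of_hasDerivAt zero_lt_one hk (fun t _ => hu t)
    (hcu'.intervalIntegrable 0 1)
  have e2 := fourierCoeffOn_of_hasDerivAt zero_lt_one hk (fun t _ => hu' t)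
    (hc.intervalIntegrable 0 1)
  rw [h0, sub_self, mul_zero] at e1
  rw [h1, sub_self, mul_zero] at e2
  rw [e1, e2]
  simp only [ofReal_one, ofReal_zero, sub_zero, zero_sub, one_mul, norm_mul, norm_neg, norm_div,
    norm_one, Complex.norm_I, Complex.norm_real, Complex.norm_intCast, Complex.norm_ofNat,
    Real.norm_of_nonneg pi_pos.le, mul_one]
  have hkpos : 0 < |(k : ℝ)| := abs_pos.2 (by exact_mod_cast hk)
  have hle : 1 / (2 * π * |(k : ℝ)|) ≤ 1 / |(k : ℝ)| := by
    refine one_div_le_one_div_of_le hkpos (le_mul_of_one_le_left hkpos.le ?_)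
    nlinarith [pi_gt_three]
  have hC0 : 0 ≤ C := (norm_nonneg _).trans hbound
  calc _ ≤ 1 / |(k : ℝ)| * (1 / |(k : ℝ)| * C) := by gcongr
    _ = C * (1 / (k : ℝ) ^ 2) := by rw [← sq_abs (k : ℝ)]; field_simp

open Real in
/-- A twice continuously differentiable function on the unit circle is the sum of its absolutely
convergent Fourier series. -/
theorem exists_hasSum_zpow_of_contDiffOn_sphere {g : ℂ → ℂ}
    (hg : ContDiffOn ℝ 2 g (Metric.sphere (0 : ℂ) 1)) :
    ∃ c : ℤ → ℂ, Summable (fun k => ‖c k‖) ∧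
      ∀ ζ ∈ Metric.sphere (0 : ℂ) 1, HasSum (fun k : ℤ => c k * ζ ^ k) (g ζ) := by
  set e : ℝ → ℂ := fun t => Complex.exp (2 * π * Complex.I * t) with he
  have he_mem : ∀ t, e t ∈ Metric.sphere (0 : ℂ) 1 := by
    intro t
    rw [mem_sphere_zero_iff_norm]
    simp only [he]
    rw [show (2 * π * Complex.I * t : ℂ) = ((2 * π * t : ℝ) : ℂ) * Complex.I by push_cast; ring]
    exact Complex.norm_exp_ofReal_mul_I _
  have he_smooth : ContDiff ℝ 2 e := by
    have : ContDiff ℝ 2 (fun t : ℝ => (t : ℂ)) := Complex.ofRealCLM.contDiff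
    exact (contDiff_const.mul this).cexp
  have he_per : Function.Periodic e 1 := by
    intro t
    simp only [he]
    push_cast
    rw [mul_add, Complex.exp_add, mul_one, Complex.exp_two_pi_mul_I, mul_one]
  have hu_smooth : ContDiff ℝ 2 (g ∘ e) := hg.comp_contDiff he_smooth he_mem
  have hper : Function.Periodic (g ∘ e) 1 := fun t => congrArg g (he_per t)
  have hd1 : ContDiff ℝ 1 (deriv (g ∘ e)) := by
    have := (contDiff_succ_iff_deriv (n := 1)).1 (by simpa [one_add_one_eq_two] using hu_smooth)
    exact this.2.2
  have hper' : deriv (g ∘ e) 1 = deriv (g ∘ e) 0 := by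
    have := deriv_comp_add_const (g ∘ e) 1 0
    rw [zero_add] at this
    rw [← this]
    exact congrArg (fun f => deriv f 0) (funext hper)
  obtain ⟨C, hC⟩ := norm_fourierCoeffOn_le
    (fun t => (hu_smooth.differentiable (by norm_num) t).hasDerivAt)
    (fun t => (hd1.differentiable (by norm_num) t).hasDerivAt)
    (hd1.continuous_deriv le_rfl) (by simpa using hper 0) hper'
  have : Fact ((0 : ℝ) < 1) := ⟨zero_lt_one⟩
  let F : C(AddCircle (1 : ℝ), ℂ) :=
    ⟨hper.lift, continuous_coinduced_dom.2 hu_smooth.continuous⟩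
  have hcoeff : ∀ k, fourierCoeff F k = fourierCoeffOn zero_lt_one (g ∘ e) k := by
    intro k
    rw [fourierCoeff_eq_intervalIntegral _ _ 0, fourierCoeffOn_eq_integral]
    simp only [fourier_coe_apply, sub_zero, zero_add]
    rfl
  have hsum : Summable (fun k => ‖fourierCoeff F k‖) := by
    refine Summable.of_norm_bounded_eventually
      ((Real.summable_one_div_int_pow (p := 2)).2 one_lt_two |>.mul_left C) ?_
    refine (Set.finite_singleton (0 : ℤ)).subset fun k hk => ?_
    by_contra hk0
    refine hk ?_
    simp only [norm_norm, hcoeff]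
    exact hC k hk0
  refine ⟨fourierCoeff F, hsum, fun ζ hζ => ?_⟩
  have hζe : e (Complex.arg ζ / (2 * π)) = ζ := by
    have h1 := Complex.norm_mul_exp_arg_mul_I ζ
    rw [mem_sphere_zero_iff_norm.1 hζ, ofReal_one, one_mul] at h1
    conv_rhs => rw [← h1]
    simp only [he]
    congr 1
    have : (π : ℂ) ≠ 0 := by exact_mod_cast pi_ne_zero
    push_cast
    field_simp
  have key := has_pointwise_sum_fourier_series_of_summable hsum.of_norm
    ((Complex.arg ζ / (2 * π) : ℝ) : AddCircle (1 : ℝ))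
  have hF : F ((Complex.arg ζ / (2 * π) : ℝ) : AddCircle (1 : ℝ)) = g ζ := congrArg g hζe
  rw [hF] at key
  convert key using 2 with k
  have hk : (fourier k ((Complex.arg ζ / (2 * π) : ℝ) : AddCircle (1 : ℝ)) : ℂ) = ζ ^ k := by
    rw [fourier_coe_apply]
    conv_rhs => rw [← hζe]
    rw [← Complex.exp_int_mul]
    congr 1
    push_cast
    ring
  rw [hk, smul_eq_mul]

/-- A smooth function on the unit circle is the boundary value of the sum of a holomorphic and an
antiholomorphic function on the disc. -/
theorem exists_add_conj_of_contDiffOn_sphere {g : ℂ → ℂ}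
    (hg : ContDiffOn ℝ 2 g (Metric.sphere (0 : ℂ) 1)) :
    ∃ P N Q R : ℂ → ℂ, IsDiscWithPrimitive P Q ∧ IsDiscWithPrimitive N R ∧
      ∀ ζ ∈ Metric.sphere (0 : ℂ) 1, g ζ = P ζ + conj (N ζ) := by
  obtain ⟨c, hc, hsum⟩ := exists_hasSum_zpow_of_contDiffOn_sphere hg
  have hpos : Summable fun k : ℕ => ‖c k‖ := hc.comp_injective Nat.cast_injective
  have hinj : Function.Injective fun k : ℕ => (-(k + 1) : ℤ) := fun i j h => by simpa using h
  have hneg : Summable fun k : ℕ => ‖conj (c (-(k + 1)))‖ := by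
    simp only [RCLike.norm_conj]
    exact hc.comp_injective hinj
  refine ⟨_, _, _, _, IsDiscWithPrimitive.of_summable hpos (fun k => k),
    IsDiscWithPrimitive.of_summable hneg (fun k => k + 1), fun ζ hζ => ?_⟩
  have hs := (hsum ζ hζ).summable
  have hζ1 : ‖ζ‖ = 1 := mem_sphere_zero_iff_norm.1 hζ
  have hs₁ : Summable fun k : ℕ => c k * ζ ^ (k : ℤ) := hs.comp_injective Nat.cast_injective
  have hs₂ : Summable fun k : ℕ => c (-(k + 1)) * ζ ^ (-(k + 1) : ℤ) := hs.comp_injective hinj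
  rw [← (hsum ζ hζ).tsum_eq, tsum_of_nat_of_neg_add_one (f := fun k : ℤ => c k * ζ ^ k) hs₁ hs₂,
    Complex.conj_tsum]
  congr 1
  refine tsum_congr fun k => ?_
  rw [map_mul, Complex.conj_conj, map_pow, ← Complex.inv_eq_conj hζ1, zpow_neg, inv_pow]
  norm_cast

/-- A smooth real function on the unit circle is the boundary value of twice the real part of a
holomorphic function on the disc. -/
theorem exists_add_conj_self_of_contDiffOn_sphere {Φ : ℂ → ℝ}
    (hΦ : ContDiffOn ℝ 2 Φ (Metric.sphere (0 : ℂ) 1)) :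
    ∃ f Q : ℂ → ℂ, IsDiscWithPrimitive f Q ∧
      ∀ ζ ∈ Metric.sphere (0 : ℂ) 1, (Φ ζ : ℂ) = f ζ + conj (f ζ) := by
  obtain ⟨P, N, Q, R, hP, hN, hPN⟩ := exists_add_conj_of_contDiffOn_sphere
    (Complex.ofRealCLM.contDiff.comp_contDiffOn hΦ)
  refine ⟨_, _, (hP.add hN).const_mul (1 / 2), fun ζ hζ => ?_⟩
  have h : (Φ ζ : ℂ) = P ζ + conj (N ζ) := hPN ζ hζ
  have h' := congrArg conj h
  simp only [Complex.conj_ofReal, map_add, Complex.conj_conj] at h'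
  simp only [map_mul, map_add, map_div₀, map_one, map_ofNat]
  linear_combination (1 / 2) * h + (1 / 2) * h'

/-- the linearized Riemann–Hilbert boundary problem at the disc `f̂_{a,λ}`
is solvable by holomorphic discs for an arbitrary smooth right-hand side
`(Φ⁰, Φ^α, Φⁿ)`. -/
theorem stmt18 (n : ℕ) [NeZero n] (A : Fin n → Fin n → ℂ)
    (hA : ∀ α β, A α β = - A β α)
    (a : ℂ) (ha : a ≠ 0) (lam : ℝ) (hlam : lam ≠ 0)
    (Φ0 : ℂ → ℝ) (Φg : Fin n → ℂ → ℂ) (Φn : ℂ → ℝ)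
    (hΦ0 : ContDiffOn ℝ (⊤ : ℕ∞) Φ0 (Metric.sphere (0:ℂ) 1))
    (hΦg : ∀ α, ContDiffOn ℝ (⊤ : ℕ∞) (Φg α) (Metric.sphere (0:ℂ) 1))
    (hΦn : ContDiffOn ℝ (⊤ : ℕ∞) Φn (Metric.sphere (0:ℂ) 1)) :
    ∃ (h : Fin n → ℂ → ℂ) (Hp : Fin n → ℂ → ℂ) (hnt : ℂ → ℂ)
      (kt : Fin n → ℂ → ℂ) (kn : ℂ → ℂ),
      -- h^α, h̃ⁿ, k̃_α, kₙ are continuous on Δ̄ and holomorphic on Δ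
      (∀ α, ContinuousOn (h α) (Metric.closedBall (0:ℂ) 1) ∧
        DifferentiableOn ℂ (h α) (Metric.ball (0:ℂ) 1)) ∧
      ContinuousOn hnt (Metric.closedBall (0:ℂ) 1) ∧
      DifferentiableOn ℂ hnt (Metric.ball (0:ℂ) 1) ∧
      (∀ α, ContinuousOn (kt α) (Metric.closedBall (0:ℂ) 1) ∧
        DifferentiableOn ℂ (kt α) (Metric.ball (0:ℂ) 1)) ∧
      ContinuousOn kn (Metric.closedBall (0:ℂ) 1) ∧
      DifferentiableOn ℂ kn (Metric.ball (0:ℂ) 1) ∧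
      -- Hp α = ℐ(h^α): the primitive of h^α vanishing at 0
      (∀ α, ContinuousOn (Hp α) (Metric.closedBall (0:ℂ) 1) ∧
        DifferentiableOn ℂ (Hp α) (Metric.ball (0:ℂ) 1) ∧
        Hp α 0 = 0 ∧
        ∀ ζ ∈ Metric.ball (0:ℂ) 1, HasDerivAt (Hp α) (h α ζ) ζ) ∧
      -- the boundary equations
      (∀ ζ ∈ Metric.sphere (0:ℂ) 1,
        -- (i)
        (hnt ζ + conj (hnt ζ) -
          (Complex.I * conj a / 2) * (∑ α : Fin n, A 0 α * conj (h α ζ)) * conj ζ +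
          (Complex.I * a / 2) * (∑ α : Fin n, conj (A 0 α) * h α ζ) * ζ +
          Complex.I * conj a * (∑ α : Fin n, A 0 α * conj (Hp α ζ)) -
          Complex.I * a * (∑ α : Fin n, conj (A 0 α) * Hp α ζ) -
          conj a * h 0 ζ * conj ζ - a * conj (h 0 ζ) * ζ = (Φ0 ζ : ℂ)) ∧
        -- (ii)
        (∀ α : Fin n,
          kt α ζ - Complex.I * a * conj (A α 0) * conj (kn ζ) * ζ +
            (if α = 0 then (1:ℂ) else 0) * conj a * kn ζ * conj ζ -
            Complex.I * lam * (∑ β : Fin n, conj (A α β) * h β ζ) * conj ζ +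
            (Complex.I * a / 2) * conj (A α 0) * ζ * kn ζ +
            (lam : ℂ) * (conj (h α ζ) +
              (Complex.I / 2) * ∑ β : Fin n, conj (A α β) * h β ζ) * ζ = Φg α ζ) ∧
        -- (iii)
        (conj ζ * kn ζ - ζ * conj (kn ζ) = Complex.I * (Φn ζ : ℂ))) := by
  have htop : (2 : WithTop ℕ∞) ≤ ((⊤ : ℕ∞) : WithTop ℕ∞) := WithTop.coe_le_coe.2 le_top
  choose P N Q R hP hN hPN using fun α => exists_add_conj_of_contDiffOn_sphere ((hΦg α).of_le htop)
  obtain ⟨f₀, q₀, hf₀, hΦ0_eq⟩ := exists_add_conj_self_of_contDiffOn_sphere (hΦ0.of_le htop)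
  obtain ⟨f₁, q₁, hf₁, hΦn_eq⟩ := exists_add_conj_self_of_contDiffOn_sphere (hΦn.of_le htop)
  have hF := hf₁.const_mul I
  set F : ℂ → ℂ := fun ζ => I * f₁ ζ with hF_def
  have hM : ∀ α, IsDiscWithPrimitive (fun ζ => N α ζ + -(I * conj a * A α 0) * F ζ)
      (fun ζ => R α ζ + -(I * conj a * A α 0) * (I * q₁ ζ)) := fun α =>
    (hN α).add (hF.const_mul _)
  set M : Fin n → ℂ → ℂ := fun α ζ => N α ζ + -(I * conj a * A α 0) * F ζ with hM_def
  have hlam' : (lam : ℂ) ≠ 0 := by exact_mod_cast hlam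
  have hH := fun α => (hM α).const_mul (lam : ℂ)⁻¹
  set S : Fin n → ℂ → ℂ := fun α ζ => (lam : ℂ)⁻¹ * M α ζ with hS_def
  set T : Fin n → ℂ → ℂ := fun α ζ =>
    (lam : ℂ)⁻¹ * (R α ζ + -(I * conj a * A α 0) * (I * q₁ ζ))
  have hcS : ∀ α, ContinuousOn (S α) (Metric.closedBall 0 1) := fun α => (hH α).1.1
  have hdS : ∀ α, DifferentiableOn ℂ (S α) (Metric.ball 0 1) := fun α => (hH α).1.2
  have hcT : ∀ α, ContinuousOn (T α) (Metric.closedBall 0 1) := fun α => (hH α).2.1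
  have hTd : ∀ α, ∀ ζ ∈ Metric.ball (0 : ℂ) 1, HasDerivAt (T α) (ζ * S α ζ) ζ :=
    fun α => (hH α).2.2.2
  have hdT : ∀ α, DifferentiableOn ℂ (T α) (Metric.ball 0 1) := fun α ζ hζ =>
    (hTd α ζ hζ).differentiableAt.differentiableWithinAt
  have hcF := hF.1.1
  have hdF := hF.1.2
  have hcf₀ := hf₀.1.1
  have hdf₀ := hf₀.1.2
  have hcP := fun α => (hP α).1.1
  have hdP := fun α => (hP α).1.2
  refine ⟨fun α ζ => ζ * S α ζ, T,
    fun ζ => f₀ ζ - (I * a / 2) * (∑ α, conj (A 0 α) * (ζ * S α ζ)) * ζ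
      + I * a * (∑ α, conj (A 0 α) * T α ζ) + conj a * S 0 ζ,
    fun α ζ => P α ζ - (if α = 0 then (1 : ℂ) else 0) * conj a * F ζ
      + I * lam * (∑ β, conj (A α β) * S β ζ) - (I * a / 2) * conj (A α 0) * ζ * (ζ * F ζ)
      - lam * ((I / 2) * ∑ β, conj (A α β) * (ζ * S β ζ)) * ζ,
    fun ζ => ζ * F ζ, fun α => ⟨by fun_prop, by fun_prop⟩, by fun_prop, by fun_prop,
    fun α => ⟨by fun_prop, by fun_prop⟩, by fun_prop, by fun_prop,
    fun α => ⟨hcT α, hdT α, (hH α).2.2.1, hTd α⟩, fun ζ hζ => ?_⟩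
  have hζζ : ζ * conj ζ = 1 := by
    rw [Complex.mul_conj, Complex.normSq_eq_norm_sq, mem_sphere_zero_iff_norm.1 hζ]
    simp
  refine ⟨?_, fun α => ?_, ?_⟩
  · rw [hΦ0_eq ζ hζ]
    simp only [map_add, map_sub, map_mul, map_sum, map_div₀, Complex.conj_conj, Complex.conj_I,
      map_ofNat]
    linear_combination (-conj a * S 0 ζ - a * conj (S 0 ζ)) * hζζ
  · have hS : ∀ β, conj (M β ζ) = lam * conj (S β ζ) := by
      intro β
      rw [hS_def]
      simp only [map_mul, map_inv₀, Complex.conj_ofReal]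
      field_simp
    have hMα : conj (M α ζ) = conj (N α ζ) + I * a * conj (A α 0) * conj (F ζ) := by
      simp [hM_def]
    have hsum : (∑ β, conj (A α β) * (ζ * S β ζ)) * conj ζ = ∑ β, conj (A α β) * S β ζ := by
      rw [Finset.sum_mul]
      refine Finset.sum_congr rfl fun β _ => ?_
      linear_combination (conj (A α β) * S β ζ) * hζζ
    rw [hPN α ζ hζ]
    simp only [map_mul]
    linear_combination (-I * lam) * hsum - hS α + hMα +
      ((if α = 0 then (1 : ℂ) else 0) * conj a * F ζ - I * a * conj (A α 0) * conj (F ζ)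
        + lam * conj (S α ζ)) * hζζ
  · rw [hΦn_eq ζ hζ]
    simp only [hF_def, map_mul, Complex.conj_I]
    linear_combination (I * f₁ ζ + I * conj (f₁ ζ)) * hζζ
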